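/- Assume ‖R₁‖ ≤ ‖R₂‖ ≤ … ≤ ‖Rₙ‖. Then min_{w ∈ W} max_{θ ∈ Θ} MSE(w,θ) = min_{w ∈ W₁} max_{θ ∈ Θ} MSE(w,θ), where W₀ = {w ∈ W : w₁ ≥ w₂ ≥ … ≥ wₙ} and W₁ = {w ∈ W₀ : wᵢ = 0 whenever C‖Rᵢ‖ ≥ 1/2}. -/

import Mathlib

/- STATEMENT 5 (Lemma lem:zero_weight): under ‖R₁‖ ≤ … ≤ ‖Rₙ‖,
   min_{w ∈ W} max_{θ ∈ Θ} MSE(w,θ) = min_{w ∈ W₁} max_{θ ∈ Θ} MSE(w,θ),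
   where W₁ = {w ∈ W₀ : wᵢ = 0 whenever C‖Rᵢ‖ ≥ 1/2}. -/

open Finset

/-- The weight set `W = {w ∈ ℝⁿ : ∑ wᵢ ≤ 1, wᵢ ≥ 0}`. -/
def Wset (n : ℕ) : Set (Fin n → ℝ) :=
  {w | (∑ i, w i) ≤ 1 ∧ ∀ i, 0 ≤ w i}

/-- The parameter set `Θ` (Lipschitz class with values in [-1/2,1/2]). -/
def ThetaSet {E : Type*} [NormedAddCommGroup E] (n : ℕ) (C : ℝ)
    (R : Fin (n + 1) → E) : Set (Fin (n + 1) → ℝ) :=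
  {θ | (∀ i, θ i ∈ Set.Icc (-(1 / 2) : ℝ) (1 / 2)) ∧
    ∀ i j, |θ i - θ j| ≤ C * ‖R i - R j‖}

/-- The mean squared error of the linear-shrinkage estimator with weights `w`. -/
noncomputable def MSE (n : ℕ) (w : Fin n → ℝ) (θ : Fin (n + 1) → ℝ) : ℝ :=
  (∑ i, w i * θ i.succ - θ 0) ^ 2 + ∑ i, (w i) ^ 2 * (1 / 4 - (θ i.succ) ^ 2)

lemma isCompact_Wset (n : ℕ) : IsCompact (Wset n) := by
  refine IsCompact.of_isClosed_subset (isCompact_Icc (a := (0 : Fin n → ℝ)) (b := 1)) ?_ ?_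
  · have h : Wset n = {w | (∑ i, w i) ≤ 1} ∩ ⋂ i, {w | 0 ≤ w i} := by
      ext w
      simp [Wset]
    rw [h]
    exact (isClosed_le (by fun_prop) continuous_const).inter
      (isClosed_iInter fun i => isClosed_le continuous_const (by fun_prop))
  · intro w hw
    exact ⟨hw.2, fun i =>
      (Finset.single_le_sum (fun j _ => hw.2 j) (Finset.mem_univ i)).trans hw.1⟩

lemma isCompact_ThetaSet {E : Type*} [NormedAddCommGroup E] (n : ℕ) (C : ℝ)
    (R : Fin (n + 1) → E) : IsCompact (ThetaSet n C R) := by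
  refine IsCompact.of_isClosed_subset (isCompact_univ_pi
    fun _ : Fin (n + 1) => isCompact_Icc (a := (-(1 / 2) : ℝ)) (b := 1 / 2)) ?_ ?_
  · have h : ThetaSet n C R = (⋂ i, {θ | θ i ∈ Set.Icc (-(1 / 2) : ℝ) (1 / 2)}) ∩
        ⋂ i, ⋂ j, {θ | |θ i - θ j| ≤ C * ‖R i - R j‖} := by
      ext θ
      simp [ThetaSet]
    rw [h]
    exact (isClosed_iInter fun i => isClosed_Icc.preimage (continuous_apply i)).inter
      (isClosed_iInter fun i => isClosed_iInter fun j =>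
        isClosed_le (by fun_prop) continuous_const)
  · intro θ hθ i _
    exact hθ.1 i

lemma continuous_MSE (n : ℕ) : Continuous fun p : (Fin n → ℝ) × (Fin (n + 1) → ℝ) =>
    MSE n p.1 p.2 := by
  unfold MSE
  fun_prop

lemma MSE_neg (n : ℕ) (w : Fin n → ℝ) (θ : Fin (n + 1) → ℝ) : MSE n w (-θ) = MSE n w θ := by
  have h : ∑ i, w i * (-θ) i.succ = -∑ i, w i * θ i.succ := by
    simp
  rw [MSE, h]
  simp only [MSE, Pi.neg_apply, neg_sq]
  ring

/-- The cone-shaped parameter with apex value `t` decreasing at rate `C`, truncated at `-1/2`. -/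
noncomputable def coneParam {E : Type*} [NormedAddCommGroup E] (n : ℕ) (C : ℝ)
    (R : Fin (n + 1) → E) (t : ℝ) : Fin (n + 1) → ℝ :=
  fun i => max (t - C * ‖R i‖) (-(1 / 2))

lemma coneParam_zero {E : Type*} [NormedAddCommGroup E] {n : ℕ} {C : ℝ}
    {R : Fin (n + 1) → E} (hR0 : R 0 = 0) {t : ℝ} (ht : 0 ≤ t) : coneParam n C R t 0 = t := by
  simp only [coneParam, hR0, norm_zero, mul_zero, sub_zero]
  exact max_eq_left (by linarith)

lemma coneParam_le {E : Type*} [NormedAddCommGroup E] {n : ℕ} {C : ℝ} (hC : 0 < C)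
    (R : Fin (n + 1) → E) {t : ℝ} (ht : 0 ≤ t) (i : Fin (n + 1)) : coneParam n C R t i ≤ t :=
  max_le (by linarith [mul_nonneg hC.le (norm_nonneg (R i))]) (by linarith)

lemma coneParam_mem {E : Type*} [NormedAddCommGroup E] {n : ℕ} {C : ℝ} (hC : 0 < C)
    (R : Fin (n + 1) → E) {t : ℝ} (ht : t ∈ Set.Icc (0 : ℝ) (1 / 2)) :
    coneParam n C R t ∈ ThetaSet n C R := by
  refine ⟨fun i => ⟨le_max_right _ _, (coneParam_le hC R ht.1 i).trans ht.2⟩, fun i j => ?_⟩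
  calc |coneParam n C R t i - coneParam n C R t j|
      ≤ |(t - C * ‖R i‖) - (t - C * ‖R j‖)| := abs_max_sub_max_le_abs _ _ _
    _ = C * |‖R j‖ - ‖R i‖| := by
      rw [← abs_of_pos hC, ← abs_mul, abs_of_pos hC]
      congr 1
      ring
    _ ≤ C * ‖R i - R j‖ := by
      rw [abs_sub_comm]
      exact mul_le_mul_of_nonneg_left (abs_norm_sub_norm_le _ _) hC.le

lemma sq_sum_sub_sum_sq_le {ι : Type*} (s : Finset ι) {u v : ι → ℝ}
    (h : ∀ i ∈ s, |u i| ≤ v i) :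
    (∑ i ∈ s, u i) ^ 2 - ∑ i ∈ s, u i ^ 2 ≤ (∑ i ∈ s, v i) ^ 2 - ∑ i ∈ s, v i ^ 2 := by
  classical
  have key : ∀ x : ι → ℝ, (∑ i ∈ s, x i) ^ 2 - ∑ i ∈ s, x i ^ 2 =
      ∑ i ∈ s, ∑ j ∈ s.erase i, x i * x j := by
    intro x
    rw [sq, Finset.sum_mul_sum, ← Finset.sum_sub_distrib]
    refine Finset.sum_congr rfl fun i hi => ?_
    rw [← Finset.add_sum_erase s _ hi]
    ring
  rw [key, key]
  refine Finset.sum_le_sum fun i hi => Finset.sum_le_sum fun j hj => ?_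
  calc u i * u j ≤ |u i| * |u j| := by
        rw [← abs_mul]
        exact le_abs_self _
    _ ≤ v i * v j := mul_le_mul (h i hi) (h j (Finset.mem_of_mem_erase hj)) (abs_nonneg _)
        ((abs_nonneg _).trans (h i hi))

/-- The error in terms of the deviations from the target value, with the squares of the
deviations separated. -/
lemma MSE_eq_deviation (n : ℕ) (w : Fin n → ℝ) (θ : Fin (n + 1) → ℝ) :
    MSE n w θ = ((∑ i, w i * (θ 0 - θ i.succ)) ^ 2 - ∑ i, (w i * (θ 0 - θ i.succ)) ^ 2) +
      2 * ((1 - ∑ i, w i) * θ 0) * (∑ i, w i * (θ 0 - θ i.succ)) +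
      ((1 - ∑ i, w i) * θ 0) ^ 2 + (1 / 4 - θ 0 ^ 2) * (∑ i, w i ^ 2) +
      2 * θ 0 * ∑ i, w i ^ 2 * (θ 0 - θ i.succ) := by
  have h₁ : ∑ i, w i * (θ 0 - θ i.succ) = (∑ i, w i) * θ 0 - ∑ i, w i * θ i.succ := by
    simp only [mul_sub, Finset.sum_sub_distrib, Finset.sum_mul]
  have h₂ : ∑ i, w i ^ 2 * (1 / 4 - θ i.succ ^ 2) = (1 / 4 - θ 0 ^ 2) * (∑ i, w i ^ 2) +
      2 * θ 0 * (∑ i, w i ^ 2 * (θ 0 - θ i.succ)) - ∑ i, (w i * (θ 0 - θ i.succ)) ^ 2 := by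
    simp only [Finset.mul_sum]
    rw [← Finset.sum_add_distrib, ← Finset.sum_sub_distrib]
    exact Finset.sum_congr rfl fun i _ => by ring
  rw [MSE, h₂, h₁]
  ring

lemma MSE_le_coneParam_of_nonneg {E : Type*} [NormedAddCommGroup E] {n : ℕ} {C : ℝ}
    {R : Fin (n + 1) → E} (hR0 : R 0 = 0) {w : Fin n → ℝ} (hw : w ∈ Wset n)
    {θ : Fin (n + 1) → ℝ} (hθ : θ ∈ ThetaSet n C R) (h0 : 0 ≤ θ 0) :
    MSE n w θ ≤ MSE n w (coneParam n C R (θ 0)) := by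
  have hdev : ∀ i : Fin n, |θ 0 - θ i.succ| ≤ θ 0 - coneParam n C R (θ 0) i.succ := by
    intro i
    have h₁ := hθ.2 i.succ 0
    have h₂ := hθ.1 i.succ
    rw [hR0, sub_zero, abs_le] at h₁
    rw [le_sub_comm]
    refine max_le ?_ ?_
    · have : |θ 0 - θ i.succ| ≤ C * ‖R i.succ‖ := abs_le.2 ⟨by linarith, by linarith⟩
      linarith
    · have : |θ 0 - θ i.succ| ≤ θ 0 + 1 / 2 := abs_le.2 ⟨by linarith [h₂.2], by linarith [h₂.1]⟩
      linarith
  have hle : ∀ i : Fin n, θ 0 - θ i.succ ≤ θ 0 - coneParam n C R (θ 0) i.succ :=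
    fun i => (le_abs_self _).trans (hdev i)
  rw [MSE_eq_deviation, MSE_eq_deviation, coneParam_zero hR0 h0]
  have hb : 0 ≤ 1 - ∑ i, w i := sub_nonneg.2 hw.1
  gcongr ?_ + _ * ?_ + _ + _ + _ * ?_
  · refine sq_sum_sub_sum_sq_le _ fun i _ => ?_
    rw [abs_mul, abs_of_nonneg (hw.2 i)]
    exact mul_le_mul_of_nonneg_left (hdev i) (hw.2 i)
  · exact Finset.sum_le_sum fun i _ => mul_le_mul_of_nonneg_left (hle i) (hw.2 i)
  · exact Finset.sum_le_sum fun i _ => mul_le_mul_of_nonneg_left (hle i) (sq_nonneg _)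

lemma exists_MSE_le_coneParam {E : Type*} [NormedAddCommGroup E] {n : ℕ} {C : ℝ}
    {R : Fin (n + 1) → E} (hR0 : R 0 = 0) {w : Fin n → ℝ} (hw : w ∈ Wset n)
    {θ : Fin (n + 1) → ℝ} (hθ : θ ∈ ThetaSet n C R) :
    ∃ t ∈ Set.Icc (0 : ℝ) (1 / 2), MSE n w θ ≤ MSE n w (coneParam n C R t) := by
  rcases le_total 0 (θ 0) with h0 | h0
  · exact ⟨θ 0, ⟨h0, (hθ.1 0).2⟩, MSE_le_coneParam_of_nonneg hR0 hw hθ h0⟩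
  · have hneg : -θ ∈ ThetaSet n C R := by
      refine ⟨fun i => ⟨?_, ?_⟩, fun i j => ?_⟩
      · exact neg_le_neg (hθ.1 i).2
      · exact neg_le.1 (hθ.1 i).1
      · rw [Pi.neg_apply, Pi.neg_apply, neg_sub_neg, abs_sub_comm]
        exact hθ.2 i j
    have h0' : 0 ≤ (-θ) 0 := neg_nonneg.2 h0
    refine ⟨(-θ) 0, ⟨h0', (hneg.1 0).2⟩, ?_⟩
    rw [← MSE_neg]
    exact MSE_le_coneParam_of_nonneg hR0 hw hneg h0'

lemma sum_comp_swap_sub {ι : Type*} [Fintype ι] [DecidableEq ι] (g : ι → ℝ → ℝ) (w : ι → ℝ)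
    {i j : ι} (hij : i ≠ j) :
    ∑ k, g k (w (Equiv.swap i j k)) - ∑ k, g k (w k) =
      (g i (w j) - g i (w i)) + (g j (w i) - g j (w j)) := by
  rw [← Finset.sum_sub_distrib, Fintype.sum_eq_add i j hij]
  · simp
  · rintro k ⟨hi, hj⟩
    rw [Equiv.swap_apply_of_ne_of_ne hi hj, sub_self]

lemma MSE_comp_swap_le {n : ℕ} {w : Fin n → ℝ} (hw : w ∈ Wset n) {θ : Fin (n + 1) → ℝ}
    (h0 : 0 ≤ θ 0) (hθ : ∀ k, θ k ≤ θ 0) {i j : Fin n} (hij : i ≠ j)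
    (hθij : θ j.succ ≤ θ i.succ) (hwij : w i ≤ w j) :
    MSE n (w ∘ Equiv.swap i j) θ ≤ MSE n w θ := by
  have h₁ := sum_comp_swap_sub (fun k x => x * θ k.succ) w hij
  have h₂ := sum_comp_swap_sub (fun k x => x ^ 2 * (1 / 4 - θ k.succ ^ 2)) w hij
  have h₃ : w i * (θ 0 - θ i.succ) + w j * (θ 0 - θ j.succ) ≤ ∑ k, w k * (θ 0 - θ k.succ) := by
    rw [← Finset.sum_pair (f := fun k => w k * (θ 0 - θ k.succ)) hij]
    exact Finset.sum_le_univ_sum_of_nonneg fun k =>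
      mul_nonneg (hw.2 k) (sub_nonneg.2 (hθ _))
  have h₄ : ∑ k, w k * (θ 0 - θ k.succ) = (∑ k, w k) * θ 0 - ∑ k, w k * θ k.succ := by
    simp only [mul_sub, Finset.sum_sub_distrib, Finset.sum_mul]
  have h₅ : (∑ k, w k) * θ 0 ≤ 1 * θ 0 := mul_le_mul_of_nonneg_right hw.1 h0
  have h₆ : 0 ≤ (w i + w j) * θ 0 := mul_nonneg (add_nonneg (hw.2 i) (hw.2 j)) h0
  have hΔ : 0 ≤ (w j - w i) * (θ i.succ - θ j.succ) :=
    mul_nonneg (sub_nonneg.2 hwij) (sub_nonneg.2 hθij)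
  simp only [MSE, Function.comp_apply]
  generalize ∑ k, w (Equiv.swap i j k) * θ k.succ = A' at *
  generalize ∑ k, w (Equiv.swap i j k) ^ 2 * (1 / 4 - θ k.succ ^ 2) = V' at *
  generalize ∑ k, w k * θ k.succ = A at *
  generalize ∑ k, w k ^ 2 * (1 / 4 - θ k.succ ^ 2) = V at *
  have hA : A' = A + (w j - w i) * (θ i.succ - θ j.succ) := by linarith
  have hV : V' = V - (w j - w i) * (θ i.succ - θ j.succ) *
      ((w i + w j) * (θ i.succ + θ j.succ)) := by linarith
  have hprod := mul_nonneg hΔ (show 0 ≤ (θ 0 - A - (w i * (θ 0 - θ i.succ) +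
    w j * (θ 0 - θ j.succ))) + (w i + w j) * θ 0 by linarith)
  subst hA hV
  nlinarith [hprod]

lemma comp_perm_mem_Wset {n : ℕ} {w : Fin n → ℝ} (hw : w ∈ Wset n) (σ : Equiv.Perm (Fin n)) :
    w ∘ σ ∈ Wset n :=
  ⟨(Equiv.sum_comp σ w).trans_le hw.1, fun i => hw.2 (σ i)⟩

/-- Sorting the weights decreasingly does not increase the error at any parameter that is
decreasing in the index. -/
lemma exists_antitone_MSE_le {n : ℕ} {w : Fin n → ℝ} (hw : w ∈ Wset n)
    (S : Set (Fin (n + 1) → ℝ))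
    (hS : ∀ θ ∈ S, 0 ≤ θ 0 ∧ (∀ k, θ k ≤ θ 0) ∧ ∀ i j : Fin n, i ≤ j → θ j.succ ≤ θ i.succ) :
    ∃ v ∈ Wset n, Antitone v ∧ ∀ θ ∈ S, MSE n v θ ≤ MSE n w θ := by
  obtain ⟨σ, hσ, hmin⟩ := Set.exists_min_image
    {σ : Equiv.Perm (Fin n) | ∀ θ ∈ S, MSE n (w ∘ σ) θ ≤ MSE n w θ}
    (fun σ => ∑ k : Fin n, ((k : ℕ) : ℝ) * w (σ k)) (Set.toFinite _) ⟨1, fun θ _ => le_rfl⟩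
  refine ⟨w ∘ σ, comp_perm_mem_Wset hw σ, fun i j hij => ?_, hσ⟩
  by_contra! hlt
  have hne : i ≠ j := by
    rintro rfl
    exact lt_irrefl _ hlt
  have hswap : σ * Equiv.swap i j ∈
      {σ : Equiv.Perm (Fin n) | ∀ θ ∈ S, MSE n (w ∘ σ) θ ≤ MSE n w θ} := fun θ hθ =>
    (MSE_comp_swap_le (comp_perm_mem_Wset hw σ) (hS θ hθ).1 (hS θ hθ).2.1 hne
      ((hS θ hθ).2.2 i j hij) hlt.le).trans (hσ θ hθ)
  have h := hmin _ hswap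
  have hdiff := sum_comp_swap_sub (fun (k : Fin n) x => ((k : ℕ) : ℝ) * x) (w ∘ σ) hne
  have hcast : ((i : ℕ) : ℝ) < ((j : ℕ) : ℝ) := by exact_mod_cast lt_of_le_of_ne hij hne
  simp only [Equiv.Perm.mul_apply] at h
  simp only [Function.comp_apply] at hdiff hlt
  nlinarith [mul_pos (sub_pos.2 hcast) (sub_pos.2 hlt)]

/-- Dropping the weights of nonpositive parameter values does not increase the error. -/
lemma MSE_le_of_eq_or_eq_zero {n : ℕ} {w v : Fin n → ℝ} (hw : w ∈ Wset n) {θ : Fin (n + 1) → ℝ}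
    (h0 : 0 ≤ θ 0) (hθ : ∀ k, θ k ≤ θ 0) (hθ' : ∀ k, θ k ∈ Set.Icc (-(1 / 2) : ℝ) (1 / 2))
    (hv : ∀ k, v k = w k ∨ v k = 0 ∧ θ k.succ ≤ 0) :
    MSE n v θ ≤ MSE n w θ := by
  have hbias : ∑ k, w k * θ k.succ ≤ ∑ k, v k * θ k.succ := by
    refine Finset.sum_le_sum fun k _ => ?_
    rcases hv k with h | ⟨h, hk⟩
    · rw [h]
    · rw [h, zero_mul]
      exact mul_nonpos_of_nonneg_of_nonpos (hw.2 k) hk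
  have hupper : ∑ k, v k * θ k.succ ≤ θ 0 := by
    calc ∑ k, v k * θ k.succ ≤ ∑ k, w k * θ 0 := by
          refine Finset.sum_le_sum fun k _ => ?_
          rcases hv k with h | ⟨h, hk⟩
          · rw [h]
            exact mul_le_mul_of_nonneg_left (hθ _) (hw.2 k)
          · rw [h, zero_mul]
            exact mul_nonneg (hw.2 k) h0
      _ = (∑ k, w k) * θ 0 := (Finset.sum_mul _ _ _).symm
      _ ≤ θ 0 := mul_le_of_le_one_left h0 hw.1
  refine add_le_add (by nlinarith) (Finset.sum_le_sum fun k _ => ?_)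
  rcases hv k with h | ⟨h, -⟩
  · rw [h]
  · have := hθ' k.succ
    rw [h, zero_pow two_ne_zero, zero_mul]
    exact mul_nonneg (sq_nonneg _) (by nlinarith [this.1, this.2])

lemma exists_MSE_coneParam_le {E : Type*} [NormedAddCommGroup E] {n : ℕ} {C : ℝ} (hC : 0 < C)
    {R : Fin (n + 1) → E} (hR0 : R 0 = 0)
    (hord : ∀ i j : Fin n, i ≤ j → ‖R i.succ‖ ≤ ‖R j.succ‖) {w : Fin n → ℝ} (hw : w ∈ Wset n) :
    ∃ v ∈ {v ∈ Wset n | (∀ i j : Fin n, i ≤ j → v j ≤ v i) ∧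
        ∀ i : Fin n, 1 / 2 ≤ C * ‖R i.succ‖ → v i = 0},
      ∀ t ∈ Set.Icc (0 : ℝ) (1 / 2),
        MSE n v (coneParam n C R t) ≤ MSE n w (coneParam n C R t) := by
  obtain ⟨u, hu, hanti, hle⟩ := exists_antitone_MSE_le hw
    (coneParam n C R '' Set.Icc (0 : ℝ) (1 / 2)) (by
      rintro _ ⟨t, ht, rfl⟩
      rw [coneParam_zero hR0 ht.1]
      refine ⟨ht.1, coneParam_le hC R ht.1, fun i j hij => max_le_max_right _ ?_⟩
      exact sub_le_sub_left (mul_le_mul_of_nonneg_left (hord i j hij) hC.le) t)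
  classical
  set v : Fin n → ℝ := fun i => if 1 / 2 ≤ C * ‖R i.succ‖ then 0 else u i with hv
  have hv0 : ∀ i, 0 ≤ v i := fun i => by
    simp only [hv]
    split_ifs
    exacts [le_rfl, hu.2 i]
  have hvu : ∀ i, v i ≤ u i := fun i => by
    simp only [hv]
    split_ifs
    exacts [hu.2 i, le_rfl]
  have hfar : ∀ i : Fin n, 1 / 2 ≤ C * ‖R i.succ‖ → v i = 0 := fun i hi => if_pos hi
  refine ⟨v, ⟨⟨(Finset.sum_le_sum fun i _ => hvu i).trans hu.1, hv0⟩, fun i j hij => ?_, hfar⟩,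
    fun t ht => ?_⟩
  · by_cases hi : 1 / 2 ≤ C * ‖R i.succ‖
    · rw [hfar j (hi.trans (mul_le_mul_of_nonneg_left (hord i j hij) hC.le))]
      exact hv0 i
    · calc v j ≤ u j := hvu j
        _ ≤ u i := hanti hij
        _ = v i := (if_neg hi).symm
  · refine (MSE_le_of_eq_or_eq_zero hu ?_ ?_ (coneParam_mem hC R ht).1 fun k => ?_).trans
      (hle _ ⟨t, ht, rfl⟩)
    · rw [coneParam_zero hR0 ht.1]
      exact ht.1
    · rw [coneParam_zero hR0 ht.1]
      exact coneParam_le hC R ht.1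
    · by_cases hk : 1 / 2 ≤ C * ‖R k.succ‖
      · exact Or.inr ⟨hfar k hk, max_le (by linarith [ht.2]) (by norm_num)⟩
      · exact Or.inl (if_neg hk)

lemma sSup_MSE_le_of_coneParam {E : Type*} [NormedAddCommGroup E] {n : ℕ} {C : ℝ} (hC : 0 < C)
    {R : Fin (n + 1) → E} (hR0 : R 0 = 0) {v w : Fin n → ℝ} (hv : v ∈ Wset n)
    (h : ∀ t ∈ Set.Icc (0 : ℝ) (1 / 2),
      MSE n v (coneParam n C R t) ≤ MSE n w (coneParam n C R t)) :
    sSup (MSE n v '' ThetaSet n C R) ≤ sSup (MSE n w '' ThetaSet n C R) := by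
  have hcont : Continuous (MSE n w) :=
    (continuous_MSE n).comp (Continuous.prodMk continuous_const continuous_id)
  have hbdd : BddAbove (MSE n w '' ThetaSet n C R) :=
    ((isCompact_ThetaSet n C R).image hcont).bddAbove
  refine csSup_le ⟨_, _, coneParam_mem hC R (t := 0) (by norm_num), rfl⟩ ?_
  rintro _ ⟨θ, hθ, rfl⟩
  obtain ⟨t, ht, hle⟩ := exists_MSE_le_coneParam hR0 hv hθ
  exact (hle.trans (h t ht)).trans (le_csSup hbdd ⟨_, coneParam_mem hC R ht, rfl⟩)

theorem stmt5 {E : Type*} [NormedAddCommGroup E] (n : ℕ) (hn : 1 ≤ n)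
    (C : ℝ) (hC : 0 < C) (R : Fin (n + 1) → E) (hR0 : R 0 = 0)
    (hord : ∀ i j : Fin n, i ≤ j → ‖R i.succ‖ ≤ ‖R j.succ‖) :
    ∃ m : ℝ,
      IsLeast ((fun w => sSup (MSE n w '' ThetaSet n C R)) '' Wset n) m ∧
      IsLeast ((fun w => sSup (MSE n w '' ThetaSet n C R)) ''
        {w ∈ Wset n | (∀ i j : Fin n, i ≤ j → w j ≤ w i) ∧
          ∀ i : Fin n, 1 / 2 ≤ C * ‖R i.succ‖ → w i = 0}) m := by
  obtain ⟨w, hw, hmin⟩ := (isCompact_Wset n).exists_isMinOn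
    (f := fun w => sSup (MSE n w '' ThetaSet n C R)) ⟨0, by simp [Wset]⟩
    ((isCompact_ThetaSet n C R).continuous_sSup (f := MSE n) (continuous_MSE n)).continuousOn
  obtain ⟨v, hv, hle⟩ := exists_MSE_coneParam_le hC hR0 hord hw
  have hlb : ∀ u ∈ Wset n, sSup (MSE n v '' ThetaSet n C R) ≤ sSup (MSE n u '' ThetaSet n C R) :=
    fun u hu => (sSup_MSE_le_of_coneParam hC hR0 hv.1 hle).trans (hmin hu)
  refine ⟨sSup (MSE n v '' ThetaSet n C R), ⟨⟨v, hv.1, rfl⟩, ?_⟩, ⟨v, hv, rfl⟩, ?_⟩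
  · rintro _ ⟨u, hu, rfl⟩
    exact hlb u hu
  · rintro _ ⟨u, hu, rfl⟩
    exact hlb u hu.1
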